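/- arXiv:1509.09202 — 2 statements merged into one kernel-verified Lean document; each statement's English description precedes it below -/
import Mathlib

section
/- Let Γ be a countable discrete group, let f ∈ ℤΓ be invertible in ℓ¹(Γ,ℝ), and let d > 0 be an expansive constant for (X_f, α_f). Then for every ε ∈ (0, d) there is a nonempty finite subset F̃ of Γ such that for every finite subset F₁ of Γ and every x ∈ X_f there exists y ∈ Δ(X_f) with ρ(sx, sy) ≤ ε for all s ∈ F₁ and ρ(e_{X_f}, sy) ≤ ε for all s ∈ Γ \ F̃F₁. -/
open scoped Pointwise
open Filter Topology

noncomputable section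

/-- The circle `ℝ/ℤ`. -/
abbrev Tcirc : Type := AddCircle (1 : ℝ)

/-- For `f = Σ_s f_s s ∈ ℤΓ` (as a finitely supported function `Γ →₀ ℤ`), the value at `t`
of `r_{f*} x`, where `f* = Σ_s f_s s⁻¹` and `(r^s x)_t = x_{t s}`; explicitly
`(r_{f*} x)_t = Σ_s f_s x_{t s⁻¹}`. -/
def rStarApply {Γ : Type*} [Group Γ] (f : Γ →₀ ℤ) (x : Γ → Tcirc) (t : Γ) : Tcirc :=
  f.sum fun s c => c • x (t * s⁻¹)

/-- `X_f = {x ∈ (ℝ/ℤ)^Γ : r_{f*} x = 0}`, as a (closed, shift-invariant) additive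
subgroup of `(ℝ/ℤ)^Γ`. -/
def XfSub {Γ : Type*} [Group Γ] (f : Γ →₀ ℤ) : AddSubgroup (Γ → Tcirc) where
  carrier := {x | ∀ t, rStarApply f x t = 0}
  zero_mem' := by
    intro t
    simp [rStarApply]
  add_mem' := by
    intro a b ha hb t
    have h : rStarApply f (a + b) t = rStarApply f a t + rStarApply f b t := by
      simp [rStarApply, Finsupp.sum, smul_add, Finset.sum_add_distrib]
    rw [h, ha t, hb t, add_zero]
  neg_mem' := by
    intro a ha t
    have h : rStarApply f (-a) t = -rStarApply f a t := by
      simp [rStarApply, Finsupp.sum]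
    rw [h, ha t, neg_zero]

/-- The left-shift action `α_f` of `Γ` on `X_f`: `(s • x)_t = x_{s⁻¹ t}`. -/
instance {Γ : Type*} [Group Γ] (f : Γ →₀ ℤ) : MulAction Γ (XfSub f) where
  smul s x := ⟨fun t => (x : Γ → Tcirc) (s⁻¹ * t), by
    intro t
    have h := x.2 (s⁻¹ * t)
    simpa [rStarApply, mul_assoc] using h⟩
  one_smul x := Subtype.ext (funext fun t => by
    show (x : Γ → Tcirc) ((1 : Γ)⁻¹ * t) = (x : Γ → Tcirc) t
    rw [inv_one, one_mul])
  mul_smul s₁ s₂ x := Subtype.ext (funext fun t => by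
    show (x : Γ → Tcirc) ((s₁ * s₂)⁻¹ * t) = (x : Γ → Tcirc) (s₂⁻¹ * (s₁⁻¹ * t))
    rw [mul_inv_rev, mul_assoc])

@[simp] lemma smul_XfSub_apply {Γ : Type*} [Group Γ] (f : Γ →₀ ℤ) (s : Γ) (x : XfSub f)
    (t : Γ) : ((s • x : XfSub f) : Γ → Tcirc) t = (x : Γ → Tcirc) (s⁻¹ * t) := rfl

/-- The convolution of two functions on `Γ`: `(u ⋆ v) t = Σ_s u s · v (s⁻¹ t)`. -/
def l1conv {Γ : Type*} [Group Γ] (u v : Γ → ℝ) : Γ → ℝ :=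
  fun t => ∑' s, u s * v (s⁻¹ * t)

/-- The identity of convolution: the indicator of `{1}`. -/
def deltaOne (Γ : Type*) [Group Γ] [DecidableEq Γ] : Γ → ℝ :=
  fun t => if t = 1 then 1 else 0

/-- `g ∈ ℓ¹(Γ,ℝ)` is a two-sided convolution inverse of `f ∈ ℤΓ`. -/
def IsL1Inverse {Γ : Type*} [Group Γ] [DecidableEq Γ] (f : Γ →₀ ℤ) (g : Γ → ℝ) : Prop :=
  Summable (fun s => |g s|) ∧
    l1conv (fun s => (f s : ℝ)) g = deltaOne Γ ∧
    l1conv g (fun s => (f s : ℝ)) = deltaOne Γ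

/-- `f ∈ ℤΓ` is invertible in `ℓ¹(Γ,ℝ)`. -/
def L1Invertible {Γ : Type*} [Group Γ] [DecidableEq Γ] (f : Γ →₀ ℤ) : Prop :=
  ∃ g : Γ → ℝ, IsL1Inverse f g

/-- The distance function of an explicitly given metric space structure. -/
def mdist {X : Type*} (m : MetricSpace X) : X → X → ℝ :=
  m.toPseudoMetricSpace.toDist.dist

/-- The topology induced by an explicitly given metric space structure. -/
def mtop {X : Type*} (m : MetricSpace X) : TopologicalSpace X :=
  m.toPseudoMetricSpace.toUniformSpace.toTopologicalSpace

end

/-- The convolution `(u ⋆ g)_t = Σ_s u_{t s⁻¹} g_s`, summed over the second factor. -/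
noncomputable def convRight {Γ : Type*} [Group Γ] (u g : Γ → ℝ) (t : Γ) : ℝ :=
  ∑' s, u (t * s⁻¹) * g s

lemma summable_convRight {Γ : Type*} [Group Γ] {u g : Γ → ℝ} (hg : Summable fun s => |g s|)
    {C : ℝ} (hu : ∀ t, |u t| ≤ C) (t : Γ) : Summable fun s => u (t * s⁻¹) * g s := by
  refine Summable.of_norm_bounded (hg.mul_left C) fun s => ?_
  rw [Real.norm_eq_abs, abs_mul]
  exact mul_le_mul_of_nonneg_right (hu _) (abs_nonneg _)

/-- An absolutely summable `g` is, up to `η`, carried by a finite window `W`. -/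
lemma exists_finset_abs_convRight_le {Γ : Type*} [Group Γ] {g : Γ → ℝ}
    (hg : Summable fun s => |g s|) (C : ℝ) {η : ℝ} (hη : 0 < η) :
    ∃ W : Finset Γ, ∀ (u : Γ → ℝ), (∀ t, |u t| ≤ C) → ∀ t, (∀ s ∈ W, u (t * s⁻¹) = 0) →
      |convRight u g t| ≤ η := by
  have hs : Summable fun s => C * |g s| := hg.mul_left C
  obtain ⟨W, hW⟩ := (hs.hasSum.eventually (lt_mem_nhds (sub_lt_self _ hη))).exists
  refine ⟨W, fun u hu t hut => ?_⟩
  have h1 : HasSum (fun s => C * |g s| - (W : Set Γ).indicator (fun s => C * |g s|) s)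
      ((∑' s, C * |g s|) - ∑ s ∈ W, C * |g s|) := by
    refine hs.hasSum.sub ?_
    rw [← Finset.sum_indicator_subset _ (Finset.Subset.refl W)]
    exact hasSum_sum_of_ne_finset_zero fun s hsW => by simp [hsW]
  have h2 : ‖convRight u g t‖ ≤ (∑' s, C * |g s|) - ∑ s ∈ W, C * |g s| := by
    refine tsum_of_norm_bounded h1 fun s => ?_
    by_cases hsW : s ∈ W
    · simp [hsW, hut s hsW]
    · rw [Real.norm_eq_abs, abs_mul]
      simpa [hsW] using mul_le_mul_of_nonneg_right (hu (t * s⁻¹)) (abs_nonneg (g s))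
  exact h2.trans (sub_le_comm.mp hW.le)

lemma convRight_sub {Γ : Type*} [Group Γ] {u v g : Γ → ℝ} (hg : Summable fun s => |g s|)
    {C : ℝ} (hu : ∀ t, |u t| ≤ C) (hv : ∀ t, |v t| ≤ C) (t : Γ) :
    convRight (u - v) g t = convRight u g t - convRight v g t := by
  simp only [convRight, Pi.sub_apply, sub_mul]
  exact (summable_convRight hg hu t).tsum_sub (summable_convRight hg hv t)

lemma convRight_deltaOne {Γ : Type*} [Group Γ] [DecidableEq Γ] (u : Γ → ℝ) (t : Γ) :
    convRight u (deltaOne Γ) t = u t := by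
  rw [convRight, tsum_eq_single 1 fun s hs => by simp [deltaOne, hs]]
  simp [deltaOne]

/-- The real-valued analogue of `rStarApply`. -/
def realStarApply {Γ : Type*} [Group Γ] (f : Γ →₀ ℤ) (u : Γ → ℝ) (t : Γ) : ℝ :=
  ∑ r ∈ f.support, (f r : ℝ) * u (t * r⁻¹)

lemma abs_realStarApply_le {Γ : Type*} [Group Γ] (f : Γ →₀ ℤ) {u : Γ → ℝ}
    (hu : ∀ t, |u t| ≤ 1) (t : Γ) : |realStarApply f u t| ≤ ∑ r ∈ f.support, |(f r : ℝ)| := by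
  refine (Finset.abs_sum_le_sum_abs _ _).trans (Finset.sum_le_sum fun r _ => ?_)
  rw [abs_mul]
  exact mul_le_of_le_one_right (abs_nonneg _) (hu _)

lemma coe_realStarApply {Γ : Type*} [Group Γ] (f : Γ →₀ ℤ) (u : Γ → ℝ) (t : Γ) :
    ((realStarApply f u t : ℝ) : Tcirc) = rStarApply f (fun s => (u s : Tcirc)) t := by
  rw [realStarApply, rStarApply, Finsupp.sum]
  refine (map_sum (QuotientAddGroup.mk' (AddSubgroup.zmultiples (1 : ℝ))) _ _).trans
    (Finset.sum_congr rfl fun r _ => ?_)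
  rw [← zsmul_eq_mul]
  exact map_zsmul (QuotientAddGroup.mk' (AddSubgroup.zmultiples (1 : ℝ))) _ _

lemma l1conv_finsupp_left {Γ : Type*} [Group Γ] (f : Γ →₀ ℤ) (g : Γ → ℝ) (p : Γ) :
    l1conv (fun s => (f s : ℝ)) g p = ∑ r ∈ f.support, (f r : ℝ) * g (r⁻¹ * p) :=
  tsum_eq_sum fun r hr => by simp [Finsupp.notMem_support_iff.mp hr]

lemma l1conv_finsupp_right {Γ : Type*} [Group Γ] (f : Γ →₀ ℤ) (g : Γ → ℝ) (p : Γ) :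
    l1conv g (fun s => (f s : ℝ)) p = realStarApply f g p := by
  rw [l1conv, realStarApply, ← (Equiv.divLeft p).tsum_eq]
  simp only [Equiv.divLeft_apply, div_eq_mul_inv, mul_inv_rev, inv_inv, inv_mul_cancel_right]
  rw [tsum_eq_sum (s := f.support) fun r hr => by simp [Finsupp.notMem_support_iff.mp hr]]
  exact Finset.sum_congr rfl fun r _ => mul_comm _ _

/-- Associativity `(u ⋆ f) ⋆ g = u ⋆ (f ⋆ g)` for bounded `u`. -/
lemma convRight_realStarApply {Γ : Type*} [Group Γ] (f : Γ →₀ ℤ) {u g : Γ → ℝ}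
    (hg : Summable fun s => |g s|) {C : ℝ} (hu : ∀ t, |u t| ≤ C) (t : Γ) :
    convRight (realStarApply f u) g t = convRight u (l1conv (fun s => (f s : ℝ)) g) t := by
  have hshift (r : Γ) : Summable fun s => |g (r⁻¹ * s)| :=
    (Equiv.mulLeft r⁻¹).summable_iff.mpr hg
  have h1 (r : Γ) : ∑' s, (f r : ℝ) * u (t * s⁻¹ * r⁻¹) * g s =
      ∑' p, u (t * p⁻¹) * ((f r : ℝ) * g (r⁻¹ * p)) := by
    rw [← (Equiv.mulLeft r⁻¹).tsum_eq]
    refine tsum_congr fun p => ?_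
    simp only [Equiv.coe_mulLeft, mul_inv_rev, inv_inv, mul_assoc, mul_inv_cancel, mul_one]
    ring
  have hs1 (r : Γ) : Summable fun s => (f r : ℝ) * u (t * s⁻¹ * r⁻¹) * g s := by
    have := (summable_convRight (u := fun q => u (q * r⁻¹)) hg (fun q => hu _) t).mul_left
      (f r : ℝ)
    simpa only [mul_assoc] using this
  have hs2 (r : Γ) : Summable fun p => u (t * p⁻¹) * ((f r : ℝ) * g (r⁻¹ * p)) := by
    have := (summable_convRight (hshift r) hu t).mul_left (f r : ℝ)
    simpa only [mul_left_comm] using this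
  simp only [convRight, realStarApply, l1conv_finsupp_left, Finset.sum_mul, Finset.mul_sum]
  rw [Summable.tsum_finsetSum fun r _ => hs1 r, Summable.tsum_finsetSum fun r _ => hs2 r]
  exact Finset.sum_congr rfl fun r _ => h1 r

/-- Associativity `(u ⋆ g) ⋆ f = u ⋆ (g ⋆ f)` for bounded `u`. -/
lemma realStarApply_convRight {Γ : Type*} [Group Γ] (f : Γ →₀ ℤ) {u g : Γ → ℝ}
    (hg : Summable fun s => |g s|) {C : ℝ} (hu : ∀ t, |u t| ≤ C) (t : Γ) :
    realStarApply f (convRight u g) t = convRight u (l1conv g fun s => (f s : ℝ)) t := by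
  have hshift (r : Γ) : Summable fun s => |g (s * r⁻¹)| :=
    (Equiv.mulRight r⁻¹).summable_iff.mpr hg
  have hs (r : Γ) : Summable fun p => u (t * p⁻¹) * ((f r : ℝ) * g (p * r⁻¹)) := by
    have := (summable_convRight (hshift r) hu t).mul_left (f r : ℝ)
    simpa only [mul_left_comm] using this
  have hconv : (l1conv g fun s => (f s : ℝ)) = realStarApply f g :=
    funext (l1conv_finsupp_right f g)
  rw [hconv]
  simp only [convRight, realStarApply, Finset.mul_sum]
  rw [Summable.tsum_finsetSum fun r _ => hs r]
  refine Finset.sum_congr rfl fun r _ => ?_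
  rw [← tsum_mul_left, ← (Equiv.mulRight r⁻¹).tsum_eq]
  refine tsum_congr fun p => ?_
  simp only [Equiv.coe_mulRight, mul_inv_rev, inv_inv, mul_assoc, inv_mul_cancel_left]
  ring

lemma norm_coe_Tcirc_le (a : ℝ) : ‖(a : Tcirc)‖ ≤ |a| :=
  QuotientAddGroup.norm_mk_le_norm

lemma exists_real_lift (x : Tcirc) : ∃ a : ℝ, |a| ≤ 1 ∧ (a : Tcirc) = x := by
  obtain ⟨a, rfl⟩ := QuotientAddGroup.mk_surjective x
  refine ⟨Int.fract a, ?_, ?_⟩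
  · rw [abs_of_nonneg (Int.fract_nonneg a)]
    exact (Int.fract_lt_one a).le
  · exact AddCircle.coe_fract a

instance compactSpace_XfSub {Γ : Type*} [Group Γ] (f : Γ →₀ ℤ) : CompactSpace (XfSub f) := by
  refine isCompact_iff_compactSpace.mp (IsClosed.isCompact ?_)
  have h : (XfSub f : Set (Γ → Tcirc)) = ⋂ t, {x | rStarApply f x t = 0} := by
    ext x
    simp [XfSub]
  rw [h]
  refine isClosed_iInter fun t => isClosed_eq ?_ continuous_const
  unfold rStarApply Finsupp.sum
  fun_prop

/-- Closeness for a compatible metric on `X_f` follows from closeness of finitely many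
coordinates. -/
lemma exists_finset_mdist_le {Γ : Type*} [Group Γ] (f : Γ →₀ ℤ) (m : MetricSpace (XfSub f))
    (hm : mtop m = inferInstanceAs (TopologicalSpace (XfSub f))) {ε : ℝ} (hε : 0 < ε) :
    ∃ (K : Finset Γ) (η : ℝ), 0 < η ∧ ∀ x y : XfSub f,
      (∀ t ∈ K, ‖(x : Γ → Tcirc) t - (y : Γ → Tcirc) t‖ ≤ η) → mdist m x y ≤ ε := by
  have hu : m.toPseudoMetricSpace.toUniformSpace =
      (inferInstance : UniformSpace (XfSub f)) :=
    unique_uniformity_of_compact hm rfl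
  have hmem : {p : XfSub f × XfSub f | mdist m p.1 p.2 < ε} ∈ uniformity (XfSub f) := by
    have h0 := @Metric.dist_mem_uniformity _ m.toPseudoMetricSpace ε hε
    rw [hu] at h0
    exact h0
  rw [uniformity_subtype, Pi.uniformity,
    ((HasBasis.iInf fun t : Γ => (Metric.uniformity_basis_dist (α := Tcirc)).comap
      fun a : (Γ → Tcirc) × (Γ → Tcirc) => (a.1 t, a.2 t)).comap _).mem_iff] at hmem
  obtain ⟨⟨I, e⟩, ⟨hI, he⟩, hsub⟩ := hmem
  have : Finite I := hI
  obtain ⟨η, hη, hle⟩ : ∃ η : ℝ, 0 < η ∧ ∀ t : I, η < e t := by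
    have h : ∀ᶠ η in 𝓝[>] (0 : ℝ), ∀ t : I, η < e t :=
      eventually_all.mpr fun t => eventually_nhdsWithin_of_eventually_nhds (gt_mem_nhds (he t))
    obtain ⟨η, h1, h2⟩ := (h.and self_mem_nhdsWithin).exists
    exact ⟨η, h2, h1⟩
  refine ⟨hI.toFinset, η, hη, fun x y hxy => le_of_lt (hsub (a := (x, y)) ?_)⟩
  simp only [Set.mem_preimage, Set.mem_iInter]
  intro t
  simpa [dist_eq_norm] using (hxy t (by simp)).trans_lt (hle t)

/-- A bounded integer-valued `u` yields a point `u ⋆ g` of `X_f`. -/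
lemma convRight_mem_XfSub {Γ : Type*} [Group Γ] [DecidableEq Γ] (f : Γ →₀ ℤ) {u g : Γ → ℝ}
    (hg : IsL1Inverse f g) {C : ℝ} (hu : ∀ t, |u t| ≤ C) (hint : ∀ t, ((u t : ℝ) : Tcirc) = 0) :
    (fun t => ((convRight u g t : ℝ) : Tcirc)) ∈ XfSub f := by
  intro t
  rw [← coe_realStarApply, realStarApply_convRight f hg.1 hu, hg.2.2, convRight_deltaOne, hint]

/-- Claim 2 of the proof of Theorem 1.2: for `f ∈ ℤΓ` invertible in `ℓ¹(Γ,ℝ)` and `d > 0`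
an expansive constant of `(X_f, α_f)`, for every `ε ∈ (0, d)` there is a nonempty finite
`F̃ ⊆ Γ` such that for every finite `F₁ ⊆ Γ` and every `x ∈ X_f` there is a point `y` in
the homoclinic group `Δ(X_f)` with `ρ(sx, sy) ≤ ε` for all `s ∈ F₁` and
`ρ(e_{X_f}, sy) ≤ ε` for all `s ∈ Γ \ F̃F₁`. -/
theorem Xf_homoclinic_approx {Γ : Type*} [Group Γ] [Countable Γ] [DecidableEq Γ]
    (f : Γ →₀ ℤ) (hf : L1Invertible f)
    (m : MetricSpace (XfSub f)) (hm : mtop m = inferInstanceAs (TopologicalSpace (XfSub f)))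
    (d : ℝ) (hd : 0 < d)
    (hexp : ∀ x y : XfSub f, (∀ s : Γ, mdist m (s • x) (s • y) ≤ d) → x = y) :
    ∀ ε : ℝ, 0 < ε → ε < d → ∃ F : Finset Γ, F.Nonempty ∧
      ∀ (F₁ : Finset Γ) (x : XfSub f), ∃ y : XfSub f,
        (∀ δ : ℝ, 0 < δ →
          {s : Γ | δ ≤ mdist m (s • y) (s • (0 : XfSub f))}.Finite) ∧
        (∀ s ∈ F₁, mdist m (s • x) (s • y) ≤ ε) ∧
        (∀ s : Γ, s ∉ (F * F₁ : Finset Γ) → mdist m (0 : XfSub f) (s • y) ≤ ε) := by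
  intro ε hε _
  obtain ⟨g, hg⟩ := hf
  obtain ⟨K, η, hη, hK⟩ := exists_finset_mdist_le f m hm hε
  set C : ℝ := ∑ r ∈ f.support, |(f r : ℝ)|
  obtain ⟨W, hW⟩ := exists_finset_abs_convRight_le hg.1 C hη
  refine ⟨insert 1 (K * (K * W⁻¹ * W)⁻¹), Finset.insert_nonempty _ _, fun F₁ x => ?_⟩
  choose a ha hax using fun t => exists_real_lift ((x : Γ → Tcirc) t)
  set z := realStarApply f a
  have hz : ∀ t, |z t| ≤ C := abs_realStarApply_le f ha
  have hz0 : ∀ t, ((z t : ℝ) : Tcirc) = 0 := fun t => by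
    rw [coe_realStarApply]
    simpa only [hax] using x.2 t
  have hzg : ∀ t, convRight z g t = a t := fun t => by
    rw [convRight_realStarApply f hg.1 ha, hg.2.1, convRight_deltaOne]
  set S : Finset Γ := F₁⁻¹ * (K * W⁻¹)
  set z' : Γ → ℝ := (S : Set Γ).indicator z
  have hz' : ∀ t, |z' t| ≤ C := fun t => by
    by_cases h : t ∈ S
    · simpa [z', h] using hz t
    · simpa [z', h] using (abs_nonneg _).trans (hz t)
  have hC : ∀ t, |(z - z') t| ≤ C := fun t => by
    by_cases h : t ∈ S
    · simpa [z', h] using (abs_nonneg _).trans (hz t)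
    · simpa [z', h] using hz t
  have hz'0 : ∀ t, ((z' t : ℝ) : Tcirc) = 0 := fun t => by
    by_cases h : t ∈ S
    · simpa [z', h] using hz0 t
    · simp [z', h]
  have hzero : ∀ (V : Finset Γ) (t : Γ), t ∉ S * V → ∀ s ∈ V, z' (t * s⁻¹) = 0 := by
    intro V t ht s hs
    refine Set.indicator_of_notMem (fun h => ht ?_) _
    simpa using Finset.mul_mem_mul (Finset.mem_coe.mp h) hs
  refine ⟨⟨_, convRight_mem_XfSub f hg hz' hz'0⟩, fun δ hδ => ?_, fun s hs => hK _ _ fun t ht => ?_,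
    fun s hs => hK _ _ fun t ht => ?_⟩
  · obtain ⟨K₂, η₂, hη₂, hK₂⟩ := exists_finset_mdist_le f m hm (half_pos hδ)
    obtain ⟨V, hV⟩ := exists_finset_abs_convRight_le hg.1 C hη₂
    refine (K₂ * (S * V)⁻¹).finite_toSet.subset fun s hs => Finset.mem_coe.mpr ?_
    by_contra hsn
    refine absurd (hK₂ _ _ fun t ht => ?_) (not_le.mpr ((half_lt_self hδ).trans_le hs))
    have hst : s⁻¹ * t ∉ S * V := fun h => hsn <| by
      simpa using Finset.mul_mem_mul ht (Finset.inv_mem_inv h)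
    simpa using (norm_coe_Tcirc_le _).trans (hV z' hz' _ (hzero V _ hst))
  · have h : |convRight (z - z') g (s⁻¹ * t)| ≤ η := hW _ hC _ fun w hw => by
      have : s⁻¹ * t * w⁻¹ ∈ S := by
        rw [mul_assoc]
        exact Finset.mul_mem_mul (Finset.inv_mem_inv hs)
          (Finset.mul_mem_mul ht (Finset.inv_mem_inv hw))
      simp [z', this]
    rw [convRight_sub hg.1 hz hz', hzg] at h
    simp only [smul_XfSub_apply, ← hax]
    exact (norm_coe_Tcirc_le _).trans h
  · have hst : s⁻¹ * t ∉ S * W := fun h => hs <| by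
      refine Finset.mul_subset_mul_right (Finset.subset_insert _ _) ?_
      have h2 : s⁻¹ * t ∈ F₁⁻¹ * (K * W⁻¹ * W) := by rwa [← mul_assoc]
      have := Finset.mul_mem_mul ht (Finset.inv_mem_inv h2)
      simpa [mul_assoc] using this
    simpa using (norm_coe_Tcirc_le _).trans (hW z' hz' _ (hzero W _ hst))
end

section
/- Let Γ be a countable discrete group and f ∈ ℤΓ. The left shift action α_f of Γ on X_f is expansive if and only if f is invertible in ℓ¹(Γ,ℝ). -/
open scoped Pointwise
open Filter Topology

noncomputable section

/-- Left convolution by `f ∈ ℤΓ`, as a finite sum. -/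
def leftConv {Γ : Type*} [Group Γ] (f : Γ →₀ ℤ) (x : Γ → ℝ) (t : Γ) : ℝ :=
  ∑ u ∈ f.support, (f u : ℝ) * x (u⁻¹ * t)

/-- Right convolution by `f ∈ ℤΓ`, as a finite sum. -/
def rightConv {Γ : Type*} [Group Γ] (f : Γ →₀ ℤ) (x : Γ → ℝ) (t : Γ) : ℝ :=
  ∑ u ∈ f.support, (f u : ℝ) * x (t * u⁻¹)

end

section Convolution

variable {Γ : Type*} [Group Γ]

lemma l1conv_coe_left (f : Γ →₀ ℤ) (x : Γ → ℝ) :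
    l1conv (fun s => (f s : ℝ)) x = leftConv f x := by
  funext t
  refine tsum_eq_sum fun s hs => ?_
  simp [Finsupp.notMem_support_iff.1 hs]

lemma l1conv_coe_right (f : Γ →₀ ℤ) (x : Γ → ℝ) :
    l1conv x (fun s => (f s : ℝ)) = rightConv f x := by
  funext t
  let e : Γ ≃ Γ := (Equiv.inv Γ).trans (Equiv.mulLeft t)
  have h : l1conv x (fun s => (f s : ℝ)) t = ∑' u, x (e u) * f ((e u)⁻¹ * t) :=
    (e.tsum_eq fun s => x s * (f (s⁻¹ * t) : ℝ)).symm
  rw [h, rightConv, tsum_eq_sum (s := f.support)]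
  · exact Finset.sum_congr rfl fun u _ => by simp [e, mul_comm]
  · intro s hs
    simp [e, Finsupp.notMem_support_iff.1 hs]

lemma leftConv_rightConv (f : Γ →₀ ℤ) (x : Γ → ℝ) :
    leftConv f (rightConv f x) = rightConv f (leftConv f x) := by
  funext t
  simp only [leftConv, rightConv, Finset.mul_sum]
  rw [Finset.sum_comm]
  refine Finset.sum_congr rfl fun u _ => Finset.sum_congr rfl fun v _ => ?_
  rw [mul_assoc v⁻¹ t u⁻¹]
  ring

lemma leftConv_deltaOne [DecidableEq Γ] (f : Γ →₀ ℤ) (t : Γ) :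
    leftConv f (deltaOne Γ) t = f t := by
  simp +contextual [leftConv, deltaOne, inv_mul_eq_one]

lemma rightConv_deltaOne [DecidableEq Γ] (f : Γ →₀ ℤ) (t : Γ) :
    rightConv f (deltaOne Γ) t = f t := by
  simp +contextual [rightConv, deltaOne, mul_inv_eq_one]

lemma leftConv_sub (f : Γ →₀ ℤ) (x y : Γ → ℝ) :
    leftConv f (x - y) = leftConv f x - leftConv f y := by
  funext t
  simp [leftConv, mul_sub, Finset.sum_sub_distrib]

lemma summable_abs_deltaOne [DecidableEq Γ] : Summable fun s => |deltaOne Γ s| := by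
  refine summable_of_ne_finset_zero (s := {1}) fun b hb => ?_
  simp_all [deltaOne]

lemma summable_abs_rightConv (f : Γ →₀ ℤ) {k : Γ → ℝ} (hk : Summable fun s => |k s|) :
    Summable fun s => |rightConv f k s| := by
  have h : Summable fun s => ∑ u ∈ f.support, |(f u : ℝ)| * |k (s * u⁻¹)| :=
    summable_sum fun u _ => ((Equiv.mulRight u⁻¹).summable_iff.2 hk).mul_left _
  refine Summable.of_nonneg_of_le (fun _ => abs_nonneg _) (fun s => ?_) h
  refine (Finset.abs_sum_le_sum_abs _ _).trans (Finset.sum_le_sum fun u _ => ?_)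
  rw [abs_mul]

/-- Pairing with `rightConv f k` is adjoint to `leftConv f`. -/
lemma hasSum_rightConv_mul_inv (f : Γ →₀ ℤ) {k q : Γ → ℝ} {C : ℝ}
    (hk : Summable fun s => |k s|) (hq : ∀ s, |q s| ≤ C) :
    HasSum (fun s => rightConv f k s * q s⁻¹) (∑' s, k s * leftConv f q s⁻¹) := by
  have hs (u : Γ) : Summable fun s => k s * q (u⁻¹ * s⁻¹) := by
    refine Summable.of_norm_bounded (hk.mul_right C) fun s => ?_
    rw [Real.norm_eq_abs, abs_mul]
    exact mul_le_mul_of_nonneg_left (hq _) (abs_nonneg _)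
  have hs' (u : Γ) : HasSum (fun s => k (s * u⁻¹) * q s⁻¹) (∑' s, k s * q (u⁻¹ * s⁻¹)) := by
    refine (Equiv.mulRight u).hasSum_iff.1 ?_
    simpa [Function.comp_def] using (hs u).hasSum
  have h1 := hasSum_sum fun u (_ : u ∈ f.support) => (hs' u).mul_left (f u : ℝ)
  have h2 := hasSum_sum fun u (_ : u ∈ f.support) => (hs u).hasSum.mul_left (f u : ℝ)
  have h3 : ∑' s, k s * leftConv f q s⁻¹
      = ∑ u ∈ f.support, (f u : ℝ) * ∑' s, k s * q (u⁻¹ * s⁻¹) := by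
    rw [← h2.tsum_eq]
    refine tsum_congr fun s => ?_
    simp only [leftConv, Finset.mul_sum]
    exact Finset.sum_congr rfl fun u _ => by ring
  rw [h3]
  refine h1.congr_fun fun s => ?_
  rw [rightConv, Finset.sum_mul]
  exact Finset.sum_congr rfl fun u _ => by ring

/-- Pairing with `leftConv f k` is adjoint to `rightConv f`. -/
lemma hasSum_leftConv_mul_inv (f : Γ →₀ ℤ) {k q : Γ → ℝ} {C : ℝ}
    (hk : Summable fun s => |k s|) (hq : ∀ s, |q s| ≤ C) :
    HasSum (fun s => leftConv f k s * q s⁻¹) (∑' s, k s * rightConv f q s⁻¹) := by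
  have hs (u : Γ) : Summable fun s => k s * q (s⁻¹ * u⁻¹) := by
    refine Summable.of_norm_bounded (hk.mul_right C) fun s => ?_
    rw [Real.norm_eq_abs, abs_mul]
    exact mul_le_mul_of_nonneg_left (hq _) (abs_nonneg _)
  have hs' (u : Γ) : HasSum (fun s => k (u⁻¹ * s) * q s⁻¹) (∑' s, k s * q (s⁻¹ * u⁻¹)) := by
    refine (Equiv.mulLeft u).hasSum_iff.1 ?_
    simpa [Function.comp_def] using (hs u).hasSum
  have h1 := hasSum_sum fun u (_ : u ∈ f.support) => (hs' u).mul_left (f u : ℝ)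
  have h2 := hasSum_sum fun u (_ : u ∈ f.support) => (hs u).hasSum.mul_left (f u : ℝ)
  have h3 : ∑' s, k s * rightConv f q s⁻¹
      = ∑ u ∈ f.support, (f u : ℝ) * ∑' s, k s * q (s⁻¹ * u⁻¹) := by
    rw [← h2.tsum_eq]
    refine tsum_congr fun s => ?_
    simp only [rightConv, Finset.mul_sum]
    exact Finset.sum_congr rfl fun u _ => by ring
  rw [h3]
  refine h1.congr_fun fun s => ?_
  rw [leftConv, Finset.sum_mul]
  exact Finset.sum_congr rfl fun u _ => by ring

lemma hasSum_deltaOne_mul_inv [DecidableEq Γ] (q : Γ → ℝ) :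
    HasSum (fun s => deltaOne Γ s * q s⁻¹) (q 1) := by
  convert hasSum_single (f := fun s => deltaOne Γ s * q s⁻¹) 1 ?_ using 1
  · simp [deltaOne]
  · intro s hs
    simp [deltaOne, hs]

/-- If `f ⋆ k = 1` with `k ∈ ℓ¹(Γ)`, then right convolution by `f` is injective on bounded
functions. -/
lemma eq_zero_of_rightConv_eq_zero [DecidableEq Γ] (f : Γ →₀ ℤ) {k v : Γ → ℝ} {C : ℝ}
    (hk : Summable fun s => |k s|) (hfk : leftConv f k = deltaOne Γ) (hv : ∀ s, |v s| ≤ C)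
    (h : rightConv f v = 0) : v = 0 := by
  funext t
  have ht : rightConv f (fun s => v (t * s)) = 0 := by
    funext s
    have := congrFun h (t * s)
    exact (Finset.sum_congr rfl fun u _ => by rw [mul_assoc t s u⁻¹]).trans this
  have h1 := hasSum_leftConv_mul_inv f hk (q := fun s => v (t * s)) fun s => hv _
  rw [hfk, ht] at h1
  have h2 := (hasSum_deltaOne_mul_inv fun s => v (t * s)).unique h1
  simpa using h2

end Convolution

section DirectFiniteness

variable {Γ : Type*} [Group Γ]

/-- The closed subspace of `ℓ²(Γ)` annihilated by left convolution by `f`. -/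
def leftKer (f : Γ →₀ ℤ) : Submodule ℝ (lp (fun _ : Γ => ℝ) 2) where
  carrier := {x | leftConv f x = 0}
  zero_mem' := by
    funext t
    simp [leftConv]
  add_mem' := by
    intro a b ha hb
    have h : leftConv f ⇑(a + b) = leftConv f a + leftConv f b := by
      funext t
      simp [leftConv, mul_add, Finset.sum_add_distrib]
    change leftConv f ⇑(a + b) = 0
    rw [h, ha, hb, add_zero]
  smul_mem' := by
    intro c a ha
    have h : leftConv f ⇑(c • a) = c • leftConv f a := by
      funext t
      simp [leftConv, mul_left_comm, Finset.mul_sum]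
    change leftConv f ⇑(c • a) = 0
    rw [h, ha, smul_zero]

lemma isClosed_leftKer (f : Γ →₀ ℤ) : IsClosed (leftKer f : Set (lp (fun _ : Γ => ℝ) 2)) := by
  have h : Continuous fun x : lp (fun _ : Γ => ℝ) 2 => leftConv f x := by
    refine continuous_pi fun t => continuous_finsetSum _ fun u _ => continuous_const.mul ?_
    exact (continuous_apply (u⁻¹ * t)).comp lp.uniformContinuous_coe.continuous
  exact isClosed_eq h continuous_const

lemma exists_leftKer_reproducing_one (f : Γ →₀ ℤ) :
    ∃ q ∈ leftKer f, ∀ x ∈ leftKer f, inner ℝ q x = x 1 := by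
  classical
  have : CompleteSpace (leftKer f) := (isClosed_leftKer f).completeSpace_coe
  refine ⟨(leftKer f).starProjection (lp.single 2 1 1), by simp, fun x hx => ?_⟩
  rw [Submodule.inner_starProjection_left_eq_right, Submodule.starProjection_eq_self_iff.2 hx,
    lp.inner_single_left]
  simp

lemma memℓp_two_mul_right {q : Γ → ℝ} (hq : Memℓp q 2) (s : Γ) :
    Memℓp (fun t => q (t * s)) 2 := by
  have h2 : 0 < (2 : ENNReal).toReal := by simp
  have h := (memℓp_gen_iff h2).1 hq
  exact (memℓp_gen_iff h2).2 ((Equiv.mulRight s).summable_iff.2 h)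

lemma memℓp_two_of_summable_abs {ι : Type*} {e : ι → ℝ} (he : Summable fun s => |e s|) : Memℓp e 2 := by
  have h1 : Memℓp e 1 := memℓp_gen (by simpa using he)
  exact h1.of_exponent_ge (by norm_num)

/-- If `f ⋆ k = 1`, then `1 - k ⋆ f` lies in the kernel of left convolution by `f`. -/
lemma exists_mem_leftKer_coe_eq [DecidableEq Γ] (f : Γ →₀ ℤ) {k : Γ → ℝ}
    (hk : Summable fun s => |k s|) (hfk : leftConv f k = deltaOne Γ) :
    ∃ e ∈ leftKer f, ⇑e = deltaOne Γ - rightConv f k := by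
  let e : Γ → ℝ := deltaOne Γ - rightConv f k
  have he : Summable fun s => |e s| := by
    refine Summable.of_nonneg_of_le (fun _ => abs_nonneg _) (fun s => ?_)
      (summable_abs_deltaOne.add (summable_abs_rightConv f hk))
    exact abs_sub _ _
  refine ⟨⟨e, memℓp_two_of_summable_abs he⟩, ?_, rfl⟩
  change leftConv f e = 0
  rw [leftConv_sub, leftConv_rightConv, hfk]
  funext t
  simp [leftConv_deltaOne, rightConv_deltaOne]

/-- The trace argument: if `f ⋆ k = 1` in `ℓ¹(Γ)`, then left convolution by `f` has trivial kernel
on `ℓ²(Γ)`. -/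
lemma leftKer_eq_bot [DecidableEq Γ] (f : Γ →₀ ℤ) {k : Γ → ℝ} (hk : Summable fun s => |k s|)
    (hfk : leftConv f k = deltaOne Γ) : leftKer f = ⊥ := by
  obtain ⟨q, hq, hrep⟩ := exists_leftKer_reproducing_one f
  have translate (x : lp (fun _ : Γ => ℝ) 2) (hx : x ∈ leftKer f) (s : Γ) :
      ∃ y ∈ leftKer f, ∀ t, y t = x (t * s) := by
    refine ⟨⟨_, memℓp_two_mul_right x.2 s⟩, ?_, fun t => rfl⟩
    funext t
    have := congrFun (show leftConv f x = 0 from hx) (t * s)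
    exact (Finset.sum_congr rfl fun u _ => by rw [← mul_assoc u⁻¹ t s]).trans this
  have hsymm (s : Γ) : q s⁻¹ = q s := by
    obtain ⟨y, hy, hys⟩ := translate q hq s
    obtain ⟨z, hz, hzs⟩ := translate q hq s⁻¹
    have h1 := hrep y hy
    have h2 := hrep z hz
    rw [lp.inner_eq_tsum] at h1 h2
    rw [hys, one_mul] at h1
    rw [hzs, one_mul] at h2
    rw [← h1, ← h2, ← (Equiv.mulRight s).tsum_eq]
    exact tsum_congr fun t => by simp [hys, hzs, mul_comm]
  obtain ⟨e, he, heq⟩ := exists_mem_leftKer_coe_eq f hk hfk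
  have hbdd (s : Γ) : |q s| ≤ ‖q‖ := lp.norm_apply_le_norm two_ne_zero q s
  have htr : e 1 = 0 := by
    have h := congrFun hfk 1
    have hone (x : Γ → ℝ) : (∑ u ∈ f.support, (f u : ℝ) * x (u⁻¹ * 1)) =
      ∑ u ∈ f.support, (f u : ℝ) * x (1 * u⁻¹) := by simp
    simp only [heq, Pi.sub_apply, rightConv, ← hone]
    rw [← h]
    simp [leftConv]
  have hq1 : q 1 = 0 := by
    have h0 : ∑' s, k s * leftConv f q s⁻¹ = 0 := by
      rw [show leftConv f q = 0 from hq]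
      simp
    have h1 := hasSum_rightConv_mul_inv f hk hbdd
    rw [h0] at h1
    have h2 := hasSum_deltaOne_mul_inv q
    have h3 := (h2.sub h1).tsum_eq
    rw [sub_zero] at h3
    have h4 := hrep e he
    rw [lp.inner_eq_tsum] at h4
    rw [← h3, ← htr]
    refine Eq.trans (tsum_congr fun s => ?_) h4
    simp only [hsymm, ← sub_mul, heq]
    rfl
  have hq0 : q = 0 := by
    have h := hrep q hq
    rw [hq1] at h
    exact inner_self_eq_zero.1 h
  rw [Submodule.eq_bot_iff]
  intro x hx
  ext s
  obtain ⟨y, hy, hys⟩ := translate x hx s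
  have h := hrep y hy
  rw [hq0, inner_zero_left, hys, one_mul] at h
  exact h.symm

/-- Direct finiteness of `ℓ¹(Γ)` for elements of `ℤΓ`: right inverses are left inverses. -/
lemma rightConv_eq_deltaOne [DecidableEq Γ] (f : Γ →₀ ℤ) {k : Γ → ℝ}
    (hk : Summable fun s => |k s|) (hfk : leftConv f k = deltaOne Γ) :
    rightConv f k = deltaOne Γ := by
  obtain ⟨e, he, heq⟩ := exists_mem_leftKer_coe_eq f hk hfk
  rw [leftKer_eq_bot f hk hfk, Submodule.mem_bot] at he
  rw [he, lp.coeFn_zero] at heq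
  exact (sub_eq_zero.1 heq.symm).symm

end DirectFiniteness

section LOne

variable {ι : Type*}

lemma summable_norm_lp_one (y : lp (fun _ : ι => ℝ) 1) : Summable fun i => ‖y i‖ := by
  simpa using (lp.hasSum_norm (p := 1) (by simp) y).summable

lemma lp_one_norm_eq_tsum (y : lp (fun _ : ι => ℝ) 1) : ‖y‖ = ∑' i, ‖y i‖ := by
  simpa using (lp.norm_eq_tsum_rpow (p := 1) (by simp) y)

variable {E : Type*} [NormedAddCommGroup E] [NormedSpace ℝ E]

lemma lp_one_ext [DecidableEq ι] {S T : lp (fun _ : ι => ℝ) 1 →L[ℝ] E}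
    (h : ∀ i, S (lp.single 1 i 1) = T (lp.single 1 i 1)) : S = T := by
  refine lp.ext_continuousLinearMap (by simp) fun i => ?_
  ext
  simpa using h i

variable [CompleteSpace E]

/-- A bounded family in a Banach space extends to a bounded operator on `ℓ¹`. -/
lemma exists_lp_one_lift [DecidableEq ι] (b : ι → E) {C : ℝ} (hC : 0 ≤ C) (hb : ∀ i, ‖b i‖ ≤ C) :
    ∃ T : lp (fun _ : ι => ℝ) 1 →L[ℝ] E, (∀ i, T (lp.single 1 i 1) = b i) ∧ ‖T‖ ≤ C := by
  have hle (y : lp (fun _ : ι => ℝ) 1) (i : ι) : ‖y i • b i‖ ≤ C * ‖y i‖ := by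
    rw [norm_smul, mul_comm]
    exact mul_le_mul_of_nonneg_right (hb i) (norm_nonneg _)
  have hs (y : lp (fun _ : ι => ℝ) 1) : Summable fun i => y i • b i :=
    Summable.of_norm_bounded ((summable_norm_lp_one y).mul_left C) (hle y)
  let L : lp (fun _ : ι => ℝ) 1 →ₗ[ℝ] E :=
    { toFun := fun y => ∑' i, y i • b i
      map_add' := fun x y => by
        rw [← (hs x).tsum_add (hs y)]
        exact tsum_congr fun i => add_smul _ _ _
      map_smul' := fun c y => by
        rw [RingHom.id_apply, ← (hs y).tsum_const_smul c]
        exact tsum_congr fun i => mul_smul _ _ _ }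
  have hL (y) : ‖L y‖ ≤ C * ‖y‖ := by
    rw [lp_one_norm_eq_tsum, ← tsum_mul_left]
    exact tsum_of_norm_bounded ((summable_norm_lp_one y).mul_left C).hasSum (hle y)
  refine ⟨L.mkContinuous C hL, fun i => ?_, L.mkContinuous_norm_le hC hL⟩
  change ∑' j, (lp.single (E := fun _ : ι => ℝ) 1 i 1) j • b j = b i
  rw [tsum_eq_single i]
  · simp
  · intro j hj
    simp [hj]

end LOne

section RightInverse

variable {Γ : Type*} [Group Γ]

lemma Submodule.topologicalClosure_eq_top_of_dual {E : Type*} [NormedAddCommGroup E]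
    [NormedSpace ℝ E] (p : Submodule ℝ E)
    (h : ∀ φ : E →L[ℝ] ℝ, (∀ x ∈ p, φ x = 0) → φ = 0) : p.topologicalClosure = ⊤ := by
  by_contra hp
  obtain ⟨x, hx⟩ : ∃ x, x ∉ p.topologicalClosure := by
    by_contra! hall
    exact hp (Submodule.eq_top_iff'.2 hall)
  obtain ⟨φ, u, hφ, hu⟩ := geometric_hahn_banach_closed_point
    p.topologicalClosure.convex p.isClosed_topologicalClosure hx
  have hzero : ∀ y ∈ p, φ y = 0 := by
    intro y hy
    by_contra hne
    have := hφ ((u / φ y) • y)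
      (p.topologicalClosure.smul_mem _ (p.le_topologicalClosure hy))
    rw [map_smul, smul_eq_mul, div_mul_cancel₀ _ hne] at this
    exact lt_irrefl _ this
  have h0 := hφ 0 p.topologicalClosure.zero_mem
  rw [h φ hzero] at h0 hu
  simp only [zero_apply] at h0 hu
  exact lt_asymm h0 hu

/-- If `rightConv f` is injective on bounded functions, then `f` has a right inverse
in `ℓ¹(Γ)`. -/
lemma exists_leftConv_eq_deltaOne [DecidableEq Γ] (f : Γ →₀ ℤ)
    (hf : ∀ (v : Γ → ℝ) (C : ℝ), (∀ t, |v t| ≤ C) → rightConv f v = 0 → v = 0) :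
    ∃ k : Γ → ℝ, (Summable fun s => |k s|) ∧ leftConv f k = deltaOne Γ := by
  let E := lp (fun _ : Γ => ℝ) 1
  let δ (s : Γ) : E := lp.single 1 s 1
  have hδ (s : Γ) : ‖δ s‖ = 1 := by
    simp [δ, lp.norm_single (E := fun _ : Γ => ℝ) (p := 1) (by simp)]
  obtain ⟨T, hT, -⟩ : ∃ T : E →L[ℝ] E,
      (∀ s, T (δ s) = ∑ u ∈ f.support, (f u : ℝ) • δ (u * s)) ∧
        ‖T‖ ≤ ∑ u ∈ f.support, |(f u : ℝ)| := by
    refine exists_lp_one_lift _ (Finset.sum_nonneg fun _ _ => abs_nonneg _) fun s => ?_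
    refine (norm_sum_le _ _).trans (Finset.sum_le_sum fun u _ => ?_)
    rw [norm_smul, hδ, mul_one, Real.norm_eq_abs]
  choose ρ hρ hρn using fun s : Γ =>
    exists_lp_one_lift (fun t => δ (t * s)) zero_le_one fun t => (hδ (t * s)).le
  have hρT (s : Γ) (x : E) : T (ρ s x) = ρ s (T x) := by
    have : T.comp (ρ s) = (ρ s).comp T := lp_one_ext fun t => by
      change T (ρ s (δ t)) = ρ s (T (δ t))
      rw [hT, map_sum, hρ, hT]
      refine Finset.sum_congr rfl fun u _ => ?_
      rw [map_smul, hρ, mul_assoc]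
    exact DFunLike.congr_fun this x
  have hρle (s : Γ) (x : E) : ‖ρ s x‖ ≤ ‖x‖ := by
    simpa using (ρ s).le_of_opNorm_le (hρn s) x
  have hTapply (x : E) (t : Γ) : (T x) t = leftConv f x t := by
    let ev (t : Γ) : E →L[ℝ] ℝ := LinearMap.mkContinuous
      { toFun := fun x => x t, map_add' := fun _ _ => rfl, map_smul' := fun _ _ => rfl } 1
      fun x => (lp.norm_apply_le_norm one_ne_zero x t).trans_eq (one_mul _).symm
    have : (ev t).comp T = ∑ u ∈ f.support, (f u : ℝ) • ev (u⁻¹ * t) := by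
      refine lp_one_ext fun s => ?_
      change ev t (T (δ s)) = _
      rw [hT, map_sum, sum_apply]
      refine Finset.sum_congr rfl fun u _ => ?_
      rw [map_smul]
      change (f u : ℝ) • (Pi.single (u * s) (1 : ℝ) : Γ → ℝ) t
        = (f u : ℝ) • (Pi.single s (1 : ℝ) : Γ → ℝ) (u⁻¹ * t)
      simp only [Pi.single_apply, inv_mul_eq_iff_eq_mul]
    have h := DFunLike.congr_fun this x
    rw [sum_apply] at h
    exact h
  have hdense : T.range.topologicalClosure = ⊤ := by
    refine Submodule.topologicalClosure_eq_top_of_dual _ fun φ hφ => lp_one_ext fun s => ?_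
    have hv : (fun t => φ (δ t⁻¹)) = 0 := by
      refine hf _ ‖φ‖ (fun t => ?_) ?_
      · simpa [hδ] using φ.le_opNorm (δ t⁻¹)
      · funext t
        have := hφ (T (δ t⁻¹)) ⟨_, rfl⟩
        rw [hT, map_sum] at this
        simpa [rightConv] using this
    simpa using congrFun hv s⁻¹
  obtain ⟨h, hh⟩ : ∃ h : E, ‖δ 1 - T h‖ < 1 := by
    have h1 : δ 1 ∈ T.range.topologicalClosure := hdense ▸ Submodule.mem_top
    obtain ⟨-, ⟨h, rfl⟩, hlt⟩ := Metric.mem_closure_iff.1 h1 1 one_pos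
    exact ⟨h, by simpa [dist_eq_norm] using hlt⟩
  obtain ⟨S, hS, -⟩ := exists_lp_one_lift (fun s => ρ s h) (norm_nonneg h) fun s => hρle s h
  obtain ⟨A, hA, hAn⟩ := exists_lp_one_lift (fun s => ρ s (δ 1 - T h)) (norm_nonneg _)
    fun s => hρle s _
  have hTS : 1 - A = T * S := by
    refine lp_one_ext fun s => ?_
    change δ s - A (δ s) = T (S (δ s))
    rw [hA, hS, hρT, map_sub, hρ, one_mul, sub_sub_cancel]
  obtain ⟨U, hU⟩ := isUnit_one_sub_of_norm_lt_one (hAn.trans_lt hh)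
  let k : E := S (((U⁻¹ : (E →L[ℝ] E)ˣ) : E →L[ℝ] E) (δ 1))
  have hk : T k = δ 1 := by
    have : (T * S) * ((U⁻¹ : (E →L[ℝ] E)ˣ) : E →L[ℝ] E) = 1 := by
      rw [← hTS, ← hU, Units.mul_inv]
    exact DFunLike.congr_fun this (δ 1)
  refine ⟨k, summable_norm_lp_one k, ?_⟩
  funext t
  rw [← hTapply, hk]
  simp [δ, deltaOne, Pi.single_apply]

end RightInverse

section Expansive

lemma exists_mdist_le_imp_dist_lt {X Y : Type*} [t : TopologicalSpace X] [hX : CompactSpace X]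
    [PseudoMetricSpace Y] (m : MetricSpace X) (hm : mtop m = t) {φ : X → Y} (hφ : Continuous φ)
    {ε : ℝ} (hε : 0 < ε) :
    ∃ d : ℝ, 0 < d ∧ ∀ x y : X, mdist m x y ≤ d → dist (φ x) (φ y) < ε := by
  subst hm
  let _ := m
  have : CompactSpace X := hX
  have hφ' : UniformContinuous φ := CompactSpace.uniformContinuous_of_continuous hφ
  obtain ⟨d, hd, h⟩ := Metric.uniformContinuous_iff.1 hφ' ε hε
  exact ⟨d / 2, half_pos hd, fun x y hxy => h (lt_of_le_of_lt hxy (half_lt_self hd))⟩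

lemma eventually_mdist_lt {X : Type*} [t : TopologicalSpace X] (m : MetricSpace X)
    (hm : mtop m = t) (a : X) {d : ℝ} (hd : 0 < d) : ∀ᶠ x in 𝓝 a, mdist m x a < d := by
  subst hm
  let _ := m
  exact Metric.ball_mem_nhds a hd

variable {Γ : Type*} [Group Γ]

lemma rStarApply_coe (f : Γ →₀ ℤ) (v : Γ → ℝ) (t : Γ) :
    rStarApply f (fun s => (v s : Tcirc)) t = (rightConv f v t : ℝ) := by
  have h (x : ℝ) : (x : Tcirc) = QuotientAddGroup.mk' (AddSubgroup.zmultiples (1 : ℝ)) x := rfl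
  simp only [rStarApply, Finsupp.sum, rightConv, h, map_sum]
  refine Finset.sum_congr rfl fun u _ => ?_
  rw [← map_zsmul, zsmul_eq_mul]

lemma isClosed_XfSub (f : Γ →₀ ℤ) : IsClosed (XfSub f : Set (Γ → Tcirc)) := by
  have : (XfSub f : Set (Γ → Tcirc)) = ⋂ t, {x | rStarApply f x t = 0} := by
    ext x
    simp only [Set.mem_iInter]
    rfl
  rw [this]
  refine isClosed_iInter fun t => isClosed_eq ?_ continuous_const
  exact continuous_finsetSum _ fun u _ => (continuous_apply _).zsmul _

lemma exists_coe_eq_abs_eq_norm (z : Tcirc) : ∃ r : ℝ, (r : Tcirc) = z ∧ |r| = ‖z‖ := by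
  obtain ⟨r, rfl⟩ := QuotientAddGroup.mk_surjective z
  refine ⟨r - round r, ?_, (UnitAddCircle.norm_eq (x := r)).symm⟩
  refine (QuotientAddGroup.eq_iff_sub_mem.2 ?_)
  exact AddSubgroup.mem_zmultiples_iff.2 ⟨-round r, by simp⟩

lemma norm_coe_eq_abs_of_le_half {r : ℝ} (hr : |r| ≤ 1 / 2) : ‖(r : Tcirc)‖ = |r| := by
  rw [AddCircle.norm_coe_eq_abs_iff _ one_ne_zero]
  simpa using hr

/-- If `f ⋆ k = 1` with `k ∈ ℓ¹(Γ)`, then `0` is the only uniformly small point of `X_f`. -/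
lemma exists_eq_zero_of_norm_lt [DecidableEq Γ] (f : Γ →₀ ℤ) {k : Γ → ℝ}
    (hk : Summable fun s => |k s|) (hfk : leftConv f k = deltaOne Γ) :
    ∃ ε : ℝ, 0 < ε ∧ ∀ z ∈ XfSub f, (∀ t, ‖z t‖ < ε) → z = 0 := by
  have hM : 0 ≤ ∑ u ∈ f.support, |(f u : ℝ)| := Finset.sum_nonneg fun _ _ => abs_nonneg _
  set M := ∑ u ∈ f.support, |(f u : ℝ)| with hMdef
  refine ⟨1 / (M + 1), by positivity, fun z hz hlt => ?_⟩
  choose v hvz hvn using fun t => exists_coe_eq_abs_eq_norm (z t)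
  have hv (t : Γ) : |v t| ≤ 1 / (M + 1) := (hvn t).trans_le (hlt t).le
  have h0 : rightConv f v = 0 := by
    funext t
    have ht : ((rightConv f v t : ℝ) : Tcirc) = 0 := by
      rw [← rStarApply_coe, funext hvz]
      exact hz t
    obtain ⟨n, hn⟩ := (AddCircle.coe_eq_zero_iff 1).1 ht
    rw [zsmul_eq_mul, mul_one] at hn
    have hle : |rightConv f v t| < 1 := by
      calc |rightConv f v t| ≤ ∑ u ∈ f.support, |(f u : ℝ)| * (1 / (M + 1)) := by
            refine (Finset.abs_sum_le_sum_abs _ _).trans (Finset.sum_le_sum fun u _ => ?_)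
            rw [abs_mul]
            exact mul_le_mul_of_nonneg_left (hv _) (abs_nonneg _)
        _ = M / (M + 1) := by rw [← Finset.sum_mul, ← hMdef, mul_one_div]
        _ < 1 := by rw [div_lt_one (by positivity)]; linarith
    rw [← hn, ← Int.cast_abs] at hle
    have : n = 0 := Int.abs_lt_one_iff.1 (by exact_mod_cast hle)
    rw [← hn, this]
    simp
  have hv0 := eq_zero_of_rightConv_eq_zero f hk hfk hv h0
  funext t
  rw [← hvz, hv0]
  simp

lemma exists_norm_lt_imp_mdist_lt (f : Γ →₀ ℤ) (m : MetricSpace (XfSub f))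
    (hm : mtop m = inferInstanceAs (TopologicalSpace (XfSub f))) {d : ℝ} (hd : 0 < d) :
    ∃ ε : ℝ, 0 < ε ∧
      ∀ x : XfSub f, (∀ t, ‖(x : Γ → Tcirc) t‖ < ε) → mdist m x 0 < d := by
  by_contra! hcon
  choose x hx hxd using fun n : ℕ => hcon (1 / (n + 1)) Nat.one_div_pos_of_nat
  have hlim : Tendsto x atTop (𝓝 0) := by
    rw [tendsto_subtype_rng, tendsto_pi_nhds]
    intro t
    exact squeeze_zero_norm (fun n => (hx n t).le) tendsto_one_div_add_atTop_nhds_zero_nat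
  obtain ⟨n, hn⟩ := (hlim.eventually (eventually_mdist_lt m hm 0 hd)).exists
  exact (hxd n).not_gt hn

end Expansive

/-- For `f ∈ ℤΓ`, the left-shift action `α_f` of `Γ` on `X_f` is expansive (with respect
to a compatible metric `ρ` on `X_f`) if and only if `f` is invertible in `ℓ¹(Γ,ℝ)`. -/
theorem Xf_expansive_iff_l1Invertible {Γ : Type*} [Group Γ] [Countable Γ] [DecidableEq Γ]
    (f : Γ →₀ ℤ)
    (m : MetricSpace (XfSub f)) (hm : mtop m = inferInstanceAs (TopologicalSpace (XfSub f))) :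
    (∃ d : ℝ, 0 < d ∧ ∀ x y : XfSub f, x ≠ y → ∃ s : Γ, d < mdist m (s • x) (s • y))
      ↔ L1Invertible f := by
  constructor
  · rintro ⟨d, hd, hexp⟩
    obtain ⟨ε, hε, hsmall⟩ := exists_norm_lt_imp_mdist_lt f m hm hd
    obtain ⟨k, hk, hfk⟩ : ∃ k : Γ → ℝ, (Summable fun s => |k s|) ∧
        leftConv f k = deltaOne Γ := by
      refine exists_leftConv_eq_deltaOne f fun v C hv h0 => ?_
      by_contra hne
      obtain ⟨t₀, ht₀⟩ := Function.ne_iff.1 hne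
      have hC : 0 ≤ C := (abs_nonneg _).trans (hv 1)
      obtain ⟨c, hc, hcε, hc2⟩ : ∃ c : ℝ, 0 < c ∧ c * C < ε ∧ c * C ≤ 1 / 2 := by
        have hmin : 0 < min ε (1 / 2) := lt_min hε one_half_pos
        have hlt : min ε (1 / 2) / (C + 1) * C < min ε (1 / 2) := by
          rw [div_mul_eq_mul_div, div_lt_iff₀ (by positivity)]
          exact mul_lt_mul_of_pos_left (lt_add_one C) hmin
        exact ⟨_, by positivity, hlt.trans_le (min_le_left _ _),
          (hlt.trans_le (min_le_right _ _)).le⟩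
      have hcv (t : Γ) : |c * v t| ≤ c * C := by
        rw [abs_mul, abs_of_pos hc]
        exact mul_le_mul_of_nonneg_left (hv t) hc.le
      let x : XfSub f := ⟨fun t => ((c * v t : ℝ) : Tcirc), fun t => by
        have hcv0 : rightConv f (fun t => c * v t) t = c * rightConv f v t := by
          simp only [rightConv, Finset.mul_sum]
          exact Finset.sum_congr rfl fun u _ => by ring
        rw [rStarApply_coe, hcv0, h0]
        simp⟩
      have hnorm (t : Γ) : ‖(x : Γ → Tcirc) t‖ = |c * v t| :=
        norm_coe_eq_abs_of_le_half ((hcv t).trans hc2)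
      have hx0 : x ≠ 0 := by
        intro hx
        have h := hnorm t₀
        rw [hx] at h
        have h' : c * v t₀ = 0 := by simpa using h.symm
        exact ht₀ ((mul_eq_zero.1 h').resolve_left hc.ne')
      obtain ⟨s, hs⟩ := hexp x 0 hx0
      have hs0 : s • (0 : XfSub f) = 0 := rfl
      rw [hs0] at hs
      refine hs.not_gt (hsmall _ fun t => ?_)
      rw [smul_XfSub_apply, hnorm]
      exact (hcv _).trans_lt hcε
    refine ⟨k, hk, ?_, ?_⟩
    · rw [l1conv_coe_left, hfk]
    · rw [l1conv_coe_right, rightConv_eq_deltaOne f hk hfk]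
  · rintro ⟨k, hk, hfk, -⟩
    rw [l1conv_coe_left] at hfk
    obtain ⟨ε, hε, hzero⟩ := exists_eq_zero_of_norm_lt f hk hfk
    have : CompactSpace (XfSub f) := isCompact_iff_compactSpace.1 (isClosed_XfSub f).isCompact
    obtain ⟨d, hd, hclose⟩ := exists_mdist_le_imp_dist_lt m hm
      (φ := fun x : XfSub f => (x : Γ → Tcirc) 1)
      ((continuous_apply 1).comp continuous_subtype_val) hε
    refine ⟨d, hd, fun x y hxy => ?_⟩
    by_contra! hle
    refine hxy (sub_eq_zero.1 (Subtype.ext (hzero _ (x - y).2 fun t => ?_)))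
    have h := hclose _ _ (hle t⁻¹)
    simpa [dist_eq_norm] using h
end
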